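/- Let ω₁, ω₂ : ℤ → ℝ be environments with ω₁(z), ω₂(z) ∈ [1/2,1) and ω₁(z) ≤ ω₂(z) for all z ∈ ℤ. Let y ∈ ℤ, let X be a random walk in the 'have your cookie and eat it' environment ω₁ on a probability space (Ω, 𝓕, P) with X_0 = y a.s., and let X' be a random walk in the 'have your cookie and eat it' environment ω₂ on a probability space (Ω', 𝓕', P') with X'_0 = y a.s. Then for all integers x < y < z and every N ≥ 1: P(T_z ≤ min(T_x, N)) ≤ P'(T'_z ≤ min(T'_x, N)), where T and T' denote the hitting times of X and X' respectively. Consequently P(T_z < T_x) ≤ P'(T'_z < T'_x) and P(T_x = ∞) ≤ P'(T'_x = ∞). -/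

import Mathlib

open MeasureTheory Filter

noncomputable section

/-- The hitting time of site `x` by the process `X`, with value `⊤` if `x` is never hit. -/
def hitTime {Ω : Type*} (X : ℕ → Ω → ℤ) (x : ℤ) (ω : Ω) : ℕ∞ :=
  ⨅ (n : ℕ) (_ : X n ω = x), (n : ℕ∞)

/-- The natural filtration of the process `X` at time `n`. -/
def natSA {Ω : Type*} (X : ℕ → Ω → ℤ) (n : ℕ) : MeasurableSpace Ω :=
  ⨆ m ∈ Finset.range (n + 1), MeasurableSpace.comap (X m) ⊤

/-- The event `A_n` that before time `n` the walk has never jumped leftward from its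
current site `X_n`. -/
def freshEvent {Ω : Type*} (X : ℕ → Ω → ℤ) (n : ℕ) : Set Ω :=
  {ω | ∀ m < n, ¬(X m ω = X n ω ∧ X (m + 1) ω = X m ω - 1)}

/-- A random walk in the "have your cookie and eat it" environment `env`. -/
structure IsCookieRW {Ω : Type*} [MeasurableSpace Ω] (P : Measure Ω)
    (env : ℤ → ℝ) (X : ℕ → Ω → ℤ) : Prop where
  envRange : ∀ x : ℤ, env x ∈ Set.Ico (1 / 2 : ℝ) 1
  meas : ∀ n, Measurable (X n)
  steps : ∀ n : ℕ, ∀ᵐ ω ∂P, |X (n + 1) ω - X n ω| = 1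
  cond : ∀ n : ℕ,
    (P[Set.indicator {ω | X (n + 1) ω = X n ω + 1} (fun _ => (1 : ℝ)) | natSA X n])
      =ᵐ[P]
    fun ω => env (X n ω) * Set.indicator (freshEvent X n) (fun _ => (1 : ℝ)) ω
      + (1 / 2) * Set.indicator (freshEvent X n)ᶜ (fun _ => (1 : ℝ)) ω

/-- The number of visits of the path `w` to the site `k` before time `n`. -/
def visits (w : ℕ → ℤ) (n : ℕ) (k : ℤ) : ℕ :=
  ((Finset.range n).filter (fun m => w m = k)).card

lemma visits_zero (w : ℕ → ℤ) (k : ℤ) : visits w 0 k = 0 := rfl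

lemma visits_succ (w : ℕ → ℤ) (n : ℕ) (k : ℤ) :
    visits w (n + 1) k = visits w n k + if w n = k then 1 else 0 := by
  unfold visits
  rw [Finset.range_add_one, Finset.filter_insert]
  split_ifs with h <;> simp

lemma visits_mono (w : ℕ → ℤ) (k : ℤ) : Monotone fun n => visits w n k :=
  monotone_nat_of_le_succ fun n => by rw [visits_succ]; exact Nat.le_add_right _ _

lemma visits_congr {v w : ℕ → ℤ} {n : ℕ} (h : ∀ i < n, v i = w i) (k : ℤ) :
    visits v n k = visits w n k := by
  unfold visits
  congr 1
  exact Finset.filter_congr fun m hm => by rw [h m (Finset.mem_range.1 hm)]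

lemma visits_eq_zero {w : ℕ → ℤ} {n : ℕ} {k : ℤ} (h : ∀ i < n, w i ≠ k) :
    visits w n k = 0 := by
  unfold visits
  rw [Finset.card_eq_zero, Finset.filter_eq_empty_iff]
  exact fun m hm => h m (Finset.mem_range.1 hm)

lemma sum_visits {w : ℕ → ℤ} {n : ℕ} {F : Finset ℤ} (h : ∀ i < n, w i ∈ F) :
    ∑ k ∈ F, visits w n k = n := by
  have := Finset.card_eq_sum_card_fiberwise (f := w) (s := Finset.range n) (t := F)
    (fun i hi => h i (by simpa using hi))
  simpa [visits] using this.symm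

lemma le_of_visits_le {v w : ℕ → ℤ} {m n : ℕ} (h : ∀ k, visits v m k ≤ visits w n k) :
    m ≤ n := by
  let F := (Finset.range m).image v ∪ (Finset.range n).image w
  have hv : ∀ i < m, v i ∈ F := fun i hi =>
    Finset.mem_union_left _ (Finset.mem_image_of_mem _ (Finset.mem_range.2 hi))
  have hw : ∀ i < n, w i ∈ F := fun i hi =>
    Finset.mem_union_right _ (Finset.mem_image_of_mem _ (Finset.mem_range.2 hi))
  rw [← sum_visits hv, ← sum_visits hw]
  exact Finset.sum_le_sum fun k _ => h k

lemma exists_visits_eq (w : ℕ → ℤ) (k : ℤ) {j : ℕ} :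
    ∀ {n : ℕ}, j < visits w n k → ∃ m < n, w m = k ∧ visits w m k = j
  | 0, h => by simp [visits_zero] at h
  | n + 1, h => by
    by_cases hj : j < visits w n k
    · obtain ⟨m, hm, h1⟩ := exists_visits_eq w k hj
      exact ⟨m, by omega, h1⟩
    · rw [visits_succ] at h
      split_ifs at h with hk
      · exact ⟨n, by omega, hk, by omega⟩
      · omega

lemma visits_lt {w : ℕ → ℤ} {m n : ℕ} (hmn : m < n) : visits w m (w m) < visits w n (w m) := by
  have h1 := visits_succ w m (w m)
  have h2 : visits w (m + 1) (w m) ≤ visits w n (w m) := visits_mono w (w m) hmn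
  simp only [if_true] at h1
  omega

lemma injective_site_visits (w : ℕ → ℤ) :
    Function.Injective fun i => (w i, visits w i (w i)) := by
  intro i j hij
  simp only [Prod.mk.injEq] at hij
  obtain ⟨h1, h2⟩ := hij
  rcases lt_trichotomy i j with h | h | h
  · have := visits_lt (w := w) h
    rw [h1] at this h2
    omega
  · exact h
  · have := visits_lt (w := w) h
    rw [← h1] at this h2
    omega

open Classical in
/-- The path `w` starts at `y` and at its `j`-th visit to `k` jumps right iff `s k j` holds. -/
structure FollowsStacks (s : ℤ → ℕ → Prop) (y : ℤ) (w : ℕ → ℤ) : Prop where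
  zero : w 0 = y
  succ : ∀ n, w (n + 1) = if s (w n) (visits w n (w n)) then w n + 1 else w n - 1

open Classical in
/-- Position and local times at time `n` of the path driven by the stacks `s`. -/
def stackState (s : ℤ → ℕ → Prop) (y : ℤ) : ℕ → ℤ × (ℤ → ℕ)
  | 0 => (y, 0)
  | n + 1 =>
    let p := stackState s y n
    (if s p.1 (p.2 p.1) then p.1 + 1 else p.1 - 1, fun k => p.2 k + if p.1 = k then 1 else 0)

/-- The path driven by the stacks `s`, started at `y`. -/
def stackWalk (s : ℤ → ℕ → Prop) (y : ℤ) (n : ℕ) : ℤ := (stackState s y n).1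

lemma stackState_snd (s : ℤ → ℕ → Prop) (y : ℤ) (n : ℕ) :
    (stackState s y n).2 = visits (stackWalk s y) n := by
  induction n with
  | zero => rfl
  | succ n ih =>
    funext k
    rw [visits_succ, ← ih]
    rfl

lemma followsStacks_stackWalk (s : ℤ → ℕ → Prop) (y : ℤ) :
    FollowsStacks s y (stackWalk s y) where
  zero := rfl
  succ n := by
    rw [← stackState_snd]
    rfl

open Classical in
/-- The number of right jumps among the first `c` entries of a stack. -/
def ups (s : ℕ → Prop) (c : ℕ) : ℕ := ((Finset.range c).filter s).card

open Classical in
/-- The number of left jumps among the first `c` entries of a stack. -/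
def downs (s : ℕ → Prop) (c : ℕ) : ℕ := ((Finset.range c).filter fun j => ¬ s j).card

lemma ups_add_downs (s : ℕ → Prop) (c : ℕ) : ups s c + downs s c = c := by
  classical
  have := Finset.card_filter_add_card_filter_not (s := Finset.range c) s
  simpa [ups, downs] using this

open Classical in
lemma ups_succ (s : ℕ → Prop) (c : ℕ) : ups s (c + 1) = ups s c + if s c then 1 else 0 := by
  unfold ups
  rw [Finset.range_add_one, Finset.filter_insert]
  split_ifs with h <;> simp

open Classical in
lemma downs_succ (s : ℕ → Prop) (c : ℕ) :
    downs s (c + 1) = downs s c + if s c then 0 else 1 := by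
  unfold downs
  rw [Finset.range_add_one, Finset.filter_insert]
  by_cases h : s c <;> simp [h]

open Classical in
lemma downs_mono (s : ℕ → Prop) : Monotone (downs s) := fun _ _ h =>
  Finset.card_le_card (Finset.filter_subset_filter _ (Finset.range_mono h))

open Classical in
lemma downs_anti {s t : ℕ → Prop} (h : ∀ j, s j → t j) (c : ℕ) : downs t c ≤ downs s c :=
  Finset.card_le_card (Finset.monotone_filter_right _ fun j _ hj hs => hj (h j hs))

namespace FollowsStacks

variable {s t : ℤ → ℕ → Prop} {y x z : ℤ} {v w : ℕ → ℤ}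

/-- Conservation of flow through the edge between `k` and `k + 1`. -/
lemma flow (h : FollowsStacks s y w) (n : ℕ) (k : ℤ) :
    (ups (s k) (visits w n k) : ℤ) - downs (s (k + 1)) (visits w n (k + 1)) =
      (if y ≤ k ∧ k < w n then 1 else 0) - if w n ≤ k ∧ k < y then 1 else 0 := by
  classical
  induction n with
  | zero =>
    rw [h.zero, if_neg (by omega)]
    simp [visits_zero, ups, downs]
  | succ n ih =>
    have h1 := h.succ n
    rw [visits_succ, visits_succ]
    by_cases a : w n = k
    · subst a
      rw [if_pos rfl, if_neg (by omega), ups_succ, add_zero]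
      by_cases b : s (w n) (visits w n (w n))
      · rw [if_pos b] at h1 ⊢
        push_cast
        split_ifs at ih ⊢ <;> omega
      · rw [if_neg b] at h1 ⊢
        push_cast
        split_ifs at ih ⊢ <;> omega
    · rw [if_neg a, add_zero]
      by_cases a' : w n = k + 1
      · rw [if_pos a', downs_succ]
        rw [a'] at h1 ih
        by_cases b : s (k + 1) (visits w n (k + 1))
        · rw [if_pos b] at h1 ⊢
          push_cast
          split_ifs at ih ⊢ <;> omega
        · rw [if_neg b] at h1 ⊢
          push_cast
          split_ifs at ih ⊢ <;> omega
      · rw [if_neg a']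
        split_ifs at h1 ih ⊢ <;> omega

/-- Before hitting `z`, the local times of a path with more right jumps are dominated by those of
the original path up to a visit of `z`. -/
lemma counts_le (hw : FollowsStacks s y w) (hv : FollowsStacks t y v)
    (hst : ∀ k j, s k j → t k j) (hyz : y < z) {T : ℕ} (hT : w T = z) :
    ∀ n : ℕ, (∀ m < n, v m ≠ z) → v n ≤ z ∧
      ∀ k, ups (t k) (visits v n k) ≤ ups (s k) (visits w T k) ∧
        downs (t k) (visits v n k) ≤ downs (s k) (visits w T k)
  | 0, _ => by
    refine ⟨by rw [hv.zero]; omega, fun k => ?_⟩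
    simp [visits_zero, ups, downs]
  | n + 1, hn => by
    classical
    obtain ⟨h1, h2⟩ := counts_le hw hv hst hyz hT n fun m hm => hn m (by omega)
    have h3 : v n < z := lt_of_le_of_ne h1 (hn n (by omega))
    have h4 := hv.succ n
    have fw := hw.flow T (v n)
    have fv := hv.flow n (v n)
    rw [hT] at fw
    have h5 := (h2 (v n)).1
    have h6 := (h2 (v n)).2
    have h7 := (h2 (v n + 1)).2
    have hlt : ups (t (v n)) (visits v n (v n)) < ups (s (v n)) (visits w T (v n)) := by
      split_ifs at fw fv <;> omega
    refine ⟨by split_ifs at h4 <;> omega, fun k => ?_⟩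
    rw [visits_succ]
    by_cases a : v n = k
    · subst a
      rw [if_pos rfl, ups_succ, downs_succ]
      by_cases b : t (v n) (visits v n (v n))
      · simp only [if_pos b]
        omega
      · simp only [if_neg b]
        refine ⟨by omega, ?_⟩
        have e1 := ups_add_downs (t (v n)) (visits v n (v n))
        have e2 := ups_add_downs (s (v n)) (visits w T (v n))
        by_contra hc
        have e3 : visits v n (v n) + 1 ≤ visits w T (v n) := by omega
        have e4 := downs_mono (t (v n)) e3
        have e5 := downs_anti (hst (v n)) (visits w T (v n))
        rw [downs_succ, if_neg b] at e4
        omega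
    · simpa only [if_neg a, add_zero] using h2 k

/-- If a stack-driven path hits `z` before `x`, then replacing left jumps by right jumps
preserves this and does not increase the hitting time. -/
lemma exists_hit (hw : FollowsStacks s y w) (hv : FollowsStacks t y v)
    (hst : ∀ k j, s k j → t k j) (hxy : x < y) (hyz : y < z) {T : ℕ} (hT : w T = z)
    (hx : ∀ m < T, w m ≠ x) : ∃ n ≤ T, v n = z ∧ ∀ m < n, v m ≠ x := by
  classical
  have key := counts_le hw hv hst hyz hT
  have hex : ∃ n, n ≤ T ∧ v n = z := by
    by_contra! hc
    have h1 := (key (T + 1) fun m hm => hc m (by omega)).2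
    have h2 : T + 1 ≤ T := le_of_visits_le (v := v) (w := w) fun k => by
      have e1 := ups_add_downs (t k) (visits v (T + 1) k)
      have e2 := ups_add_downs (s k) (visits w T k)
      have := h1 k
      omega
    omega
  obtain ⟨h1, h2⟩ := Nat.find_spec hex
  refine ⟨Nat.find hex, h1, h2, fun m hm hmx => ?_⟩
  have h3 := ((key m fun i hi hvi => Nat.find_min hex (hi.trans hm) ⟨by omega, hvi⟩).2 (x + 1)).2
  have fw := hw.flow T x
  have fv := hv.flow m x
  rw [hT, visits_eq_zero hx] at fw
  rw [hmx] at fv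
  simp only [ups, Finset.range_zero, Finset.filter_empty, Finset.card_empty] at fw
  split_ifs at fw fv <;> omega

end FollowsStacks

/-- The probability of a right jump of the cookie random walk at time `i`, given that its path so
far is `w`. -/
def rightProb (env : ℤ → ℝ) (w : ℕ → ℤ) (i : ℕ) : ℝ :=
  if ∀ m < i, ¬(w m = w i ∧ w (m + 1) = w m - 1) then env (w i) else 1 / 2

/-- The probability that the cookie random walk with past path `w` up to time `i` jumps to
`w (i + 1)`. -/
def stepProb (env : ℤ → ℝ) (w : ℕ → ℤ) (i : ℕ) : ℝ :=
  if w (i + 1) = w i + 1 then rightProb env w i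
  else if w (i + 1) = w i - 1 then 1 - rightProb env w i else 0

lemma rightProb_mem {env : ℤ → ℝ} (h : ∀ z, env z ∈ Set.Ico (1 / 2 : ℝ) 1) (w : ℕ → ℤ) (i : ℕ) :
    rightProb env w i ∈ Set.Icc (1 / 2 : ℝ) 1 := by
  unfold rightProb
  split_ifs
  · exact ⟨(h _).1, (h _).2.le⟩
  · norm_num

namespace IsCookieRW

variable {Ω : Type*} {env : ℤ → ℝ} {X : ℕ → Ω → ℤ}

lemma measurableSet_natSA {n m : ℕ} (hm : m ≤ n) (s : Set ℤ) :
    MeasurableSet[natSA X n] {ω | X m ω ∈ s} := by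
  have : MeasurableSpace.comap (X m) ⊤ ≤ natSA X n :=
    le_iSup₂_of_le m (Finset.mem_range.2 (by omega)) le_rfl
  exact this _ ⟨s, trivial, rfl⟩

lemma measurableSet_natSA_forall (n : ℕ) (s : ℕ → Set ℤ) :
    MeasurableSet[natSA X n] {ω | ∀ i ≤ n, X i ω ∈ s i} := by
  have : {ω | ∀ i ≤ n, X i ω ∈ s i} = ⋂ i, ⋂ (_ : i ≤ n), {ω | X i ω ∈ s i} := by
    ext; simp
  rw [this]
  exact MeasurableSet.iInter fun i => MeasurableSet.iInter fun hi => measurableSet_natSA hi _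

lemma condRHS_eq (ω : Ω) (n : ℕ) :
    env (X n ω) * Set.indicator (freshEvent X n) (fun _ => (1 : ℝ)) ω
      + (1 / 2) * Set.indicator (freshEvent X n)ᶜ (fun _ => (1 : ℝ)) ω =
    rightProb env (fun i => X i ω) n := by
  unfold rightProb
  by_cases h : ω ∈ freshEvent X n
  · have h' : ∀ m < n, ¬(X m ω = X n ω ∧ X (m + 1) ω = X m ω - 1) := h
    rw [if_pos h', Set.indicator_of_mem h, Set.indicator_of_notMem (by simpa using h)]
    ring
  · have h' : ¬ ∀ m < n, ¬(X m ω = X n ω ∧ X (m + 1) ω = X m ω - 1) := h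
    rw [if_neg h', Set.indicator_of_notMem h, Set.indicator_of_mem (by simpa using h)]
    ring

variable [MeasurableSpace Ω] {P : Measure Ω}

lemma natSA_le (hX : IsCookieRW P env X) (n : ℕ) : natSA X n ≤ ‹MeasurableSpace Ω› :=
  iSup₂_le fun m _ => (hX.meas m).comap_le

lemma measurableSet_right (hX : IsCookieRW P env X) (n : ℕ) :
    MeasurableSet {ω | X (n + 1) ω = X n ω + 1} :=
  measurableSet_eq_fun (hX.meas _) ((hX.meas n).add_const 1)

variable [IsProbabilityMeasure P]

lemma real_inter_right (hX : IsCookieRW P env X) (n : ℕ) {A : Set Ω}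
    (hA : MeasurableSet[natSA X n] A) :
    P.real (A ∩ {ω | X (n + 1) ω = X n ω + 1}) =
      ∫ ω in A, rightProb env (fun i => X i ω) n ∂P := by
  have hR := hX.measurableSet_right n
  have hi : Integrable (Set.indicator {ω | X (n + 1) ω = X n ω + 1} fun _ => (1 : ℝ)) P :=
    (integrable_const 1).indicator hR
  have h1 := setIntegral_condExp (hX.natSA_le n) hi hA
  have h2 : ∫ ω in A, (P[Set.indicator {ω | X (n + 1) ω = X n ω + 1} (fun _ => (1 : ℝ)) |
      natSA X n]) ω ∂P = ∫ ω in A, rightProb env (fun i => X i ω) n ∂P :=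
    setIntegral_congr_ae (hX.natSA_le n A hA) <| by
      filter_upwards [hX.cond n] with ω hω _
      rw [hω, condRHS_eq]
  rw [← h2, h1, setIntegral_indicator hR, setIntegral_const, smul_eq_mul, mul_one]

lemma half_mul_le_real_inter_right (hX : IsCookieRW P env X) (n : ℕ) {A : Set Ω}
    (hA : MeasurableSet[natSA X n] A) :
    1 / 2 * P.real A ≤ P.real (A ∩ {ω | X (n + 1) ω = X n ω + 1}) := by
  have hR := hX.measurableSet_right n
  have hi : Integrable (Set.indicator {ω | X (n + 1) ω = X n ω + 1} fun _ => (1 : ℝ)) P :=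
    (integrable_const 1).indicator hR
  have hprob : Integrable (fun ω => rightProb env (fun i => X i ω) n) P := by
    refine (integrable_condExp (m := natSA X n)
      (f := Set.indicator {ω | X (n + 1) ω = X n ω + 1} fun _ => (1 : ℝ))).congr ?_
    filter_upwards [hX.cond n] with ω hω
    rw [hω, condRHS_eq]
  rw [hX.real_inter_right n hA]
  have : ∫ _ in A, (1 / 2 : ℝ) ∂P ≤ ∫ ω in A, rightProb env (fun i => X i ω) n ∂P :=
    setIntegral_mono (integrable_const _).integrableOn hprob.integrableOn fun ω =>
      (rightProb_mem hX.envRange _ n).1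
  rwa [setIntegral_const, smul_eq_mul, mul_comm] at this

lemma real_cylinder (hX : IsCookieRW P env X) {y : ℤ} (hX0 : ∀ᵐ ω ∂P, X 0 ω = y) (w : ℕ → ℤ)
    (n : ℕ) : P.real {ω | ∀ i ≤ n, X i ω = w i} =
      if w 0 = y then ∏ i ∈ Finset.range n, stepProb env w i else 0 := by
  induction n with
  | zero =>
    rw [measureReal_congr (t := {_ω | y = w 0})
      (by
        filter_upwards [hX0] with ω hω
        refine propext ?_
        change (∀ i ≤ 0, X i ω = w i) ↔ y = w 0
        simp [hω])]
    by_cases h : w 0 = y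
    · simp [h]
    · simp [h, Ne.symm h]
  | succ n ih =>
    set A := {ω | ∀ i ≤ n, X i ω = w i} with hAdef
    have hA : MeasurableSet[natSA X n] A := measurableSet_natSA_forall n fun i => {w i}
    have hAm := hX.natSA_le n A hA
    have hright : P.real (A ∩ {ω | X (n + 1) ω = X n ω + 1}) =
        P.real A * rightProb env w n := by
      rw [hX.real_inter_right n hA, setIntegral_congr_fun (g := fun _ => rightProb env w n) hAm,
        setIntegral_const, smul_eq_mul]
      intro ω hω
      have e : ∀ i ≤ n, X i ω = w i := hω
      simp only [rightProb]
      rw [e n le_rfl]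
      congr 1
      refine propext (forall₂_congr fun m hm => ?_)
      rw [e m hm.le, e (m + 1) hm]
    have hsplit : {ω | ∀ i ≤ n + 1, X i ω = w i} = A ∩ {ω | X (n + 1) ω = w (n + 1)} := by
      ext ω
      simp only [hAdef, Set.mem_inter_iff, Set.mem_ofPred_eq, Nat.le_succ_iff]
      constructor
      · exact fun h => ⟨fun i hi => h i (Or.inl hi), h _ (Or.inr rfl)⟩
      · rintro ⟨h1, h2⟩ i (hi | rfl)
        exacts [h1 i hi, h2]
    have hstep : P.real {ω | ∀ i ≤ n + 1, X i ω = w i} = P.real A * stepProb env w n := by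
      rw [hsplit]
      unfold stepProb
      split_ifs with h1 h2
      · rw [← hright]
        congr 1
        ext ω
        simp only [hAdef, Set.mem_inter_iff, Set.mem_ofPred_eq, and_congr_right_iff]
        intro h
        rw [h n le_rfl, h1]
      · have : P.real (A ∩ {ω | X (n + 1) ω = w (n + 1)}) =
            P.real (A \ {ω | X (n + 1) ω = X n ω + 1}) := by
          apply measureReal_congr
          filter_upwards [hX.steps n] with ω hω
          refine propext ?_
          change (ω ∈ A ∧ X (n + 1) ω = w (n + 1)) ↔ (ω ∈ A ∧ ¬ X (n + 1) ω = X n ω + 1)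
          refine and_congr_right fun h => ?_
          have := h n le_rfl
          rcases (abs_eq zero_le_one).1 hω with h | h <;> omega
        have hd := measureReal_inter_add_sdiff (μ := P) (s := A) (hX.measurableSet_right n)
        rw [this]
        linarith
      · rw [mul_zero, measureReal_congr (t := ∅), measureReal_empty]
        filter_upwards [hX.steps n] with ω hω
        refine propext ?_
        change (ω ∈ A ∧ X (n + 1) ω = w (n + 1)) ↔ False
        refine iff_false_intro fun ⟨h, h'⟩ => ?_
        have := h n le_rfl
        rcases (abs_eq zero_le_one).1 hω with h | h <;> omega
    rw [hstep, ih, Finset.prod_range_succ]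
    split_ifs <;> simp

end IsCookieRW

/-- The stack of jumps at `k` driven by the uniform variables `u`: an entry is a right jump iff
its variable lies below `env k` (before the first left jump) or `1 / 2` (afterwards). -/
def cookieStack (env : ℤ → ℝ) (u : ℤ × ℕ → ℝ) (k : ℤ) (j : ℕ) : Prop :=
  u (k, j) < open Classical in if ∀ i < j, u (k, i) < env k then env k else 1 / 2

lemma cookieStack_mono {env₁ env₂ : ℤ → ℝ} (h₂ : ∀ z, env₂ z ∈ Set.Ico (1 / 2 : ℝ) 1)
    (hle : ∀ z, env₁ z ≤ env₂ z) (u : ℤ × ℕ → ℝ) (k : ℤ) (j : ℕ)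
    (h : cookieStack env₁ u k j) : cookieStack env₂ u k j := by
  unfold cookieStack at *
  refine h.trans_le ?_
  have := (h₂ k).1
  split_ifs with a b b
  · exact hle k
  · exact absurd (fun i hi => (a i hi).trans_le (hle k)) b
  · exact this
  · rfl

lemma forall_cookieStack_iff (env : ℤ → ℝ) (u : ℤ × ℕ → ℝ) (k : ℤ) (j : ℕ) :
    (∀ i < j, cookieStack env u k i) ↔ ∀ i < j, u (k, i) < env k := by
  induction j with
  | zero => simp
  | succ j ih =>
    rw [Nat.forall_lt_succ_right, Nat.forall_lt_succ_right, ih]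
    refine and_congr_right fun h => ?_
    unfold cookieStack
    rw [if_pos h]

/-- The set of values of the uniform variable used at time `i` for which the path continues
along `w`. -/
def stepSet (env : ℤ → ℝ) (w : ℕ → ℤ) (i : ℕ) : Set ℝ :=
  if w (i + 1) = w i + 1 then Set.Iio (rightProb env w i)
  else if w (i + 1) = w i - 1 then Set.Ici (rightProb env w i) else ∅

lemma measurableSet_stepSet (env : ℤ → ℝ) (w : ℕ → ℤ) (i : ℕ) :
    MeasurableSet (stepSet env w i) := by
  unfold stepSet
  split_ifs
  exacts [measurableSet_Iio, measurableSet_Ici, MeasurableSet.empty]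

lemma stackWalk_eq_iff (env : ℤ → ℝ) (y : ℤ) (u : ℤ × ℕ → ℝ) (w : ℕ → ℤ) (n : ℕ) :
    (∀ i ≤ n, stackWalk (cookieStack env u) y i = w i) ↔
      w 0 = y ∧ ∀ i < n, u (w i, visits w i (w i)) ∈ stepSet env w i := by
  have hf := followsStacks_stackWalk (cookieStack env u) y
  generalize stackWalk (cookieStack env u) y = v at hf
  induction n with
  | zero => simp [hf.zero, eq_comm]
  | succ n ih =>
    have hsplit : (∀ i ≤ n + 1, v i = w i) ↔ (∀ i ≤ n, v i = w i) ∧ v (n + 1) = w (n + 1) := by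
      simp only [Nat.le_succ_iff]
      exact ⟨fun h => ⟨fun i hi => h i (Or.inl hi), h _ (Or.inr rfl)⟩,
        fun h i hi => hi.elim (h.1 i) fun e => e ▸ h.2⟩
    rw [hsplit, Nat.forall_lt_succ_right, ← and_assoc]
    refine (and_congr_right ?_).trans (and_congr_left' ih)
    intro h
    have hv := hf.succ n
    have hvis : visits v n (w n) = visits w n (w n) :=
      visits_congr (fun i hi => h i hi.le) _
    rw [h n le_rfl, hvis] at hv
    have hfresh : (∀ i < visits w n (w n), u (w n, i) < env (w n)) ↔
        ∀ m < n, ¬(w m = w n ∧ w (m + 1) = w m - 1) := by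
      rw [← forall_cookieStack_iff]
      have hstep : ∀ m < n, w m = w n →
          (cookieStack env u (w n) (visits w m (w n)) ↔ ¬ w (m + 1) = w m - 1) := by
        intro m hm hmn
        have h1 := hf.succ m
        rw [h m hm.le, h (m + 1) hm, visits_congr (w := w) (fun i hi => h i (by omega)), hmn] at h1
        rw [h1, hmn]
        split_ifs with hc
        · simp only [hc, true_iff]; omega
        · simp [hc]
      constructor
      · rintro h1 m hm ⟨h2, h3⟩
        have := visits_lt (w := w) hm
        rw [h2] at this
        exact (hstep m hm h2).1 (h1 _ this) h3
      · intro h1 i hi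
        obtain ⟨m, hm, hmn, rfl⟩ := exists_visits_eq w (w n) hi
        exact (hstep m hm hmn).2 fun h3 => h1 m hm ⟨hmn, h3⟩
    have hstack : cookieStack env u (w n) (visits w n (w n)) ↔
        u (w n, visits w n (w n)) < rightProb env w n := by
      unfold cookieStack rightProb
      simp only [hfresh]
    rw [hv]
    unfold stepSet
    by_cases hc : cookieStack env u (w n) (visits w n (w n))
    · rw [if_pos hc]
      rw [hstack] at hc
      split_ifs with h1 h2
      · simpa [h1] using hc
      · simp only [Set.mem_Ici, not_le.2 hc, iff_false]; omega
      · simp only [Set.mem_empty_iff_false, iff_false]; omega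
    · rw [if_neg hc]
      rw [hstack] at hc
      split_ifs with h1 h2
      · simp only [Set.mem_Iio, hc, iff_false]; omega
      · simpa [h2] using not_lt.1 hc
      · simp only [Set.mem_empty_iff_false, iff_false]; omega

/-- The uniform distribution on `[0, 1]`, as a measure on `ℝ`. -/
def unifMeasure : Measure ℝ := volume.restrict (Set.Icc 0 1)

instance : IsProbabilityMeasure unifMeasure :=
  ⟨by simp [unifMeasure]⟩

lemma unifMeasure_real_Iio {a : ℝ} (ha : a ∈ Set.Icc (0 : ℝ) 1) :
    unifMeasure.real (Set.Iio a) = a := by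
  have : Set.Iio a ∩ Set.Icc 0 1 = Set.Ico 0 a := by
    ext t
    simp only [Set.mem_inter_iff, Set.mem_Iio, Set.mem_Icc, Set.mem_Ico]
    exact ⟨fun h => ⟨h.2.1, h.1⟩, fun h => ⟨h.2, h.1, h.2.le.trans ha.2⟩⟩
  rw [unifMeasure, measureReal_restrict_apply measurableSet_Iio, this,
    Real.volume_real_Ico_of_le ha.1, sub_zero]

/-- The joint law of the uniform variables driving the stacks. -/
def unifLaw : Measure (ℤ × ℕ → ℝ) := Measure.infinitePi fun _ => unifMeasure

instance : IsProbabilityMeasure unifLaw := by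
  unfold unifLaw
  infer_instance

lemma unifMeasure_real_stepSet {env : ℤ → ℝ} (h : ∀ z, env z ∈ Set.Ico (1 / 2 : ℝ) 1)
    (w : ℕ → ℤ) (i : ℕ) : unifMeasure.real (stepSet env w i) = stepProb env w i := by
  obtain ⟨h1, h2⟩ := rightProb_mem h w i
  have hI := unifMeasure_real_Iio ⟨by linarith, h2⟩
  unfold stepSet stepProb
  split_ifs
  · exact hI
  · rw [← Set.compl_Iio, probReal_compl_eq_one_sub measurableSet_Iio, hI]
  · exact measureReal_empty

lemma stackWalk_cylinder_eq (env : ℤ → ℝ) (y : ℤ) (w : ℕ → ℤ) (n : ℕ) :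
    {u | ∀ i ≤ n, stackWalk (cookieStack env u) y i = w i} =
      {_u | w 0 = y} ∩ ⋂ i ∈ Finset.range n,
        (fun u : ℤ × ℕ → ℝ => u (w i, visits w i (w i))) ⁻¹' stepSet env w i := by
  ext u
  simp [stackWalk_eq_iff]

lemma real_stackWalk_cylinder {env : ℤ → ℝ} (h : ∀ z, env z ∈ Set.Ico (1 / 2 : ℝ) 1) (y : ℤ)
    (w : ℕ → ℤ) (n : ℕ) :
    unifLaw.real {u | ∀ i ≤ n, stackWalk (cookieStack env u) y i = w i} =
      if w 0 = y then ∏ i ∈ Finset.range n, stepProb env w i else 0 := by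
  rw [stackWalk_cylinder_eq]
  split_ifs with h0
  · simp only [h0, Set.ofPred_true, Set.univ_inter]
    have hind : ProbabilityTheory.iIndepFun
        (fun (p : ℤ × ℕ) (u : ℤ × ℕ → ℝ) => u p) unifLaw :=
      ProbabilityTheory.iIndepFun_infinitePi (P := fun _ : ℤ × ℕ => unifMeasure)
        (X := fun _ t => t) fun _ => measurable_id
    have := (hind.precomp (injective_site_visits w)).measure_inter_preimage_eq_mul
      (Finset.range n) (sets := stepSet env w) fun i _ => measurableSet_stepSet env w i
    rw [measureReal_def, this, ENNReal.toReal_prod]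
    refine Finset.prod_congr rfl fun i _ => ?_
    rw [← unifMeasure_real_stepSet h, measureReal_def]
    congr 1
    exact (measurePreserving_eval_infinitePi (fun _ : ℤ × ℕ => unifMeasure) _).measure_preimage
      (measurableSet_stepSet env w i).nullMeasurableSet
  · simp [h0]

lemma prefix_preimage_singleton {Ω : Type*} {N : ℕ} (Y : ℕ → Ω → ℤ) (f : Fin (N + 1) → ℤ) :
    (fun ω => fun i : Fin (N + 1) => Y i ω) ⁻¹' {f} =
      {ω | ∀ i ≤ N, Y i ω = f (Fin.ofNat (N + 1) i)} := by
  ext ω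
  simp only [Set.mem_preimage, Set.mem_singleton_iff, Set.mem_ofPred_eq, funext_iff]
  constructor
  · intro h i hi
    rw [← h]
    simp [Nat.mod_eq_of_lt (Nat.lt_succ_of_le hi)]
  · intro h i
    rw [h i (by omega)]
    congr 1
    ext
    simp

lemma measurable_stackWalk (env : ℤ → ℝ) (y : ℤ) (n : ℕ) :
    Measurable fun u => fun i : Fin (n + 1) => stackWalk (cookieStack env u) y i := by
  refine measurable_to_countable' fun f => ?_
  rw [prefix_preimage_singleton fun i u => stackWalk (cookieStack env u) y i]
  rw [stackWalk_cylinder_eq env y fun i => f (Fin.ofNat (n + 1) i)]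
  exact (MeasurableSet.const _).inter <| Finset.measurableSet_biInter _ fun i _ =>
    measurable_pi_apply _ (measurableSet_stepSet env _ i)

/-- The event of hitting `z` before `x` by time `N`, for a path up to time `N`. -/
def hitBefore (x z : ℤ) (N : ℕ) : Set (Fin (N + 1) → ℤ) :=
  {f | ∃ t, f t = z ∧ ∀ m < t, f m ≠ x}

lemma mem_hitBefore_iff {x z : ℤ} {N : ℕ} (v : ℕ → ℤ) :
    (fun i : Fin (N + 1) => v i) ∈ hitBefore x z N ↔ ∃ t ≤ N, v t = z ∧ ∀ m < t, v m ≠ x := by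
  constructor
  · rintro ⟨t, h1, h2⟩
    exact ⟨t, by omega, h1, fun m hm => h2 ⟨m, by omega⟩ hm⟩
  · rintro ⟨t, ht, h1, h2⟩
    exact ⟨⟨t, by omega⟩, h1, fun m hm => h2 m hm⟩

section HittingTimes

variable {Ω : Type*} {X : ℕ → Ω → ℤ} {ω : Ω} {x z : ℤ}

lemma hitTime_le_coe_iff {N : ℕ} : hitTime X z ω ≤ N ↔ ∃ t ≤ N, X t ω = z := by
  constructor
  · intro h
    have h1 : hitTime X z ω < (N + 1 : ℕ) :=
      h.trans_lt (by exact_mod_cast Nat.lt_succ_self N)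
    unfold hitTime at h1
    simp only [iInf_lt_iff, Nat.cast_lt] at h1
    obtain ⟨t, ht, h2⟩ := h1
    exact ⟨t, by omega, ht⟩
  · rintro ⟨t, ht, h⟩
    exact (iInf₂_le t h).trans (by exact_mod_cast ht)

lemma hitTime_lt_hitTime_iff :
    hitTime X z ω < hitTime X x ω ↔ ∃ t, X t ω = z ∧ ∀ m ≤ t, X m ω ≠ x := by
  constructor
  · intro h
    obtain ⟨t, ht⟩ := ENat.ne_top_iff_exists.1 (ne_top_of_lt h)
    obtain ⟨s, hs, hsz⟩ := hitTime_le_coe_iff.1 ht.ge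
    refine ⟨s, hsz, fun m hm hmx => ?_⟩
    have h1 : hitTime X x ω ≤ t := hitTime_le_coe_iff.2 ⟨m, by omega, hmx⟩
    exact absurd (h.trans_le h1) (by rw [← ht]; exact lt_irrefl _)
  · rintro ⟨t, h1, h2⟩
    have h3 : hitTime X z ω ≤ t := hitTime_le_coe_iff.2 ⟨t, le_rfl, h1⟩
    refine h3.trans_lt (not_le.1 fun h4 => ?_)
    obtain ⟨s, hs, hsx⟩ := hitTime_le_coe_iff.1 h4
    exact h2 s hs hsx

lemma hitTime_eq_top_iff : hitTime X x ω = ⊤ ↔ ∀ m, X m ω ≠ x := by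
  simp [hitTime]

lemma hitTime_le_min_iff (hxz : x ≠ z) {N : ℕ} :
    hitTime X z ω ≤ min (hitTime X x ω) N ↔ ∃ t ≤ N, X t ω = z ∧ ∀ m < t, X m ω ≠ x := by
  rw [le_min_iff]
  constructor
  · rintro ⟨h1, h2⟩
    have h3 := hitTime_le_coe_iff.1 h2
    classical
    obtain ⟨h4, h5⟩ := Nat.find_spec h3
    refine ⟨Nat.find h3, h4, h5, fun m hm hmx => ?_⟩
    have h6 : hitTime X z ω ≤ m := h1.trans (hitTime_le_coe_iff.2 ⟨m, le_rfl, hmx⟩)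
    obtain ⟨s, hs, hsz⟩ := hitTime_le_coe_iff.1 h6
    exact Nat.find_min h3 (hs.trans_lt hm) ⟨by omega, hsz⟩
  · rintro ⟨t, ht, h1, h2⟩
    refine ⟨(hitTime_lt_hitTime_iff.2 ⟨t, h1, fun m hm hmx => ?_⟩).le,
      hitTime_le_coe_iff.2 ⟨t, ht, h1⟩⟩
    rcases hm.lt_or_eq with hm | rfl
    exacts [h2 m hm hmx, hxz (hmx.symm.trans h1)]

lemma hitTime_lt_eq_iUnion (hxz : x ≠ z) :
    {ω | hitTime X z ω < hitTime X x ω} =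
      ⋃ N : ℕ, {ω | hitTime X z ω ≤ min (hitTime X x ω) N} := by
  ext ω
  simp only [Set.mem_ofPred_eq, Set.mem_iUnion, hitTime_le_min_iff hxz, hitTime_lt_hitTime_iff]
  constructor
  · rintro ⟨t, h1, h2⟩
    exact ⟨t, t, le_rfl, h1, fun m hm => h2 m hm.le⟩
  · rintro ⟨N, t, -, h1, h2⟩
    refine ⟨t, h1, fun m hm => ?_⟩
    rcases hm.lt_or_eq with hm | rfl
    exacts [h2 m hm, h1 ▸ hxz.symm]

lemma monotone_hitTime_le_min :
    Monotone fun N : ℕ => {ω | hitTime X z ω ≤ min (hitTime X x ω) N} :=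
  fun _ _ hmn ω (hω : hitTime X z ω ≤ _) => hω.trans (min_le_min_left _ (Nat.cast_le.2 hmn))

end HittingTimes

lemma le_add_of_steps {v : ℕ → ℤ} (h : ∀ n, |v (n + 1) - v n| = 1) (n : ℕ) : v n ≤ v 0 + n := by
  induction n with
  | zero => simp
  | succ n ih =>
    rcases (abs_eq zero_le_one).1 (h n) with h | h <;> push_cast <;> omega

lemma mem_Ioo_of_steps {v : ℕ → ℤ} (h : ∀ n, |v (n + 1) - v n| = 1) {x z : ℤ}
    (h0 : v 0 ∈ Set.Ioo x z) (hx : ∀ n, v n ≠ x) (hz : ∀ n, v n ≠ z) (n : ℕ) :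
    v n ∈ Set.Ioo x z := by
  induction n with
  | zero => exact h0
  | succ n ih =>
    have hx' := hx (n + 1)
    have hz' := hz (n + 1)
    obtain ⟨h1, h2⟩ := ih
    constructor <;> rcases (abs_eq zero_le_one).1 (h n) with h | h <;> omega

namespace IsCookieRW

variable {Ω : Type*} [MeasurableSpace Ω] {P : Measure Ω}
  {env : ℤ → ℝ} {X : ℕ → Ω → ℤ}

lemma measure_hitTime_lt_le (hX : IsCookieRW P env X) {y : ℤ} (hX0 : ∀ᵐ ω ∂P, X 0 ω = y)
    (x : ℤ) (n : ℕ) :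
    P {ω | hitTime X (y + n + 1) ω < hitTime X x ω} ≤ P {ω | ∀ m ≤ n, X m ω ≠ x} := by
  refine measure_mono_ae ?_
  filter_upwards [hX0, ae_all_iff.2 hX.steps] with ω h0 hs hlt
  obtain ⟨t, h1, h2⟩ := hitTime_lt_hitTime_iff.1 hlt
  have h3 := le_add_of_steps (v := fun n => X n ω) hs t
  intro m hm
  refine h2 m ?_
  simp only [h0, h1] at h3
  omega

variable [IsProbabilityMeasure P]

lemma measure_prefix_eq (hX : IsCookieRW P env X) {y : ℤ} (hX0 : ∀ᵐ ω ∂P, X 0 ω = y) {N : ℕ}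
    (E : Set (Fin (N + 1) → ℤ)) :
    P {ω | (fun i : Fin (N + 1) => X i ω) ∈ E} =
      unifLaw {u | (fun i : Fin (N + 1) => stackWalk (cookieStack env u) y i) ∈ E} := by
  have m1 : Measurable fun ω => fun i : Fin (N + 1) => X i ω :=
    measurable_pi_lambda _ fun i => hX.meas i
  have m2 : Measurable fun u => fun i : Fin (N + 1) => stackWalk (cookieStack env u) y i :=
    measurable_stackWalk env y N
  have key : P.map (fun ω => fun i : Fin (N + 1) => X i ω) =
      unifLaw.map fun u => fun i : Fin (N + 1) => stackWalk (cookieStack env u) y i := by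
    refine Measure.ext_of_singleton fun f => ?_
    rw [Measure.map_apply m1 (measurableSet_singleton f),
      Measure.map_apply m2 (measurableSet_singleton f)]
    rw [prefix_preimage_singleton X,
      prefix_preimage_singleton fun i u => stackWalk (cookieStack env u) y i,
      ← measureReal_eq_measureReal_iff, hX.real_cylinder hX0 fun i => f (Fin.ofNat (N + 1) i)]
    exact (real_stackWalk_cylinder hX.envRange y (fun i => f (Fin.ofNat (N + 1) i)) N).symm
  have hE : MeasurableSet E := E.to_countable.measurableSet
  have h := congrArg (fun ν => ν E) key
  simp only [Measure.map_apply m1 hE, Measure.map_apply m2 hE] at h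
  exact h

lemma measure_forall_mem_Ioo (hX : IsCookieRW P env X) (x z : ℤ) :
    P {ω | ∀ n, X n ω ∈ Set.Ioo x z} = 0 := by
  set S : ℕ → Set Ω := fun n => {ω | ∀ i ≤ n, X i ω ∈ Set.Ioo x z} with hS
  let R : ℕ → ℕ → Set Ω := fun n m => {ω | ∀ j < m, X (n + j + 1) ω = X (n + j) ω + 1}
  have hanti : Antitone S := fun a b hab ω hω i hi => hω i (hi.trans hab)
  have hSm : ∀ n, MeasurableSet (S n) := fun n =>
    hX.natSA_le n _ (measurableSet_natSA_forall n fun _ => Set.Ioo x z)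
  have hSR : ∀ n m, MeasurableSet[natSA X (n + m)] (S n ∩ R n m) := by
    intro n m
    have hmX : ∀ i ≤ n + m, Measurable[natSA X (n + m)] (X i) := fun i hi s _ =>
      measurableSet_natSA hi s
    have e : S n ∩ R n m = (⋂ i, ⋂ (_ : i ≤ n), {ω | X i ω ∈ Set.Ioo x z}) ∩
        ⋂ j, ⋂ (_ : j < m), {ω | X (n + j + 1) ω = X (n + j) ω + 1} := by
      ext; simp [hS, R]
    rw [e]
    refine MeasurableSet.inter
      (MeasurableSet.iInter fun i => MeasurableSet.iInter fun hi =>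
        measurableSet_natSA (by omega) _)
      (MeasurableSet.iInter fun j => MeasurableSet.iInter fun hj => ?_)
    exact measurableSet_eq_fun (hmX _ (by omega)) ((hmX _ (by omega)).add_const 1)
  have hlow : ∀ n m, (1 / 2 : ℝ) ^ m * P.real (S n) ≤ P.real (S n ∩ R n m) := by
    intro n m
    induction m with
    | zero => simp [R]
    | succ m ih =>
      have h1 := hX.half_mul_le_real_inter_right (n + m) (hSR n m)
      have h2 : S n ∩ R n m ∩ {ω | X (n + m + 1) ω = X (n + m) ω + 1} = S n ∩ R n (m + 1) := by
        ext ω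
        simp only [R, Set.mem_inter_iff, Set.mem_ofPred_eq, Nat.forall_lt_succ_right, and_assoc]
      rw [h2] at h1
      rw [pow_succ]
      linarith
  set M := (z - x).toNat with hM
  have hup : ∀ n, P.real (S n ∩ R n M) ≤ P.real (S n) - P.real (S (n + M)) := by
    intro n
    rw [← measureReal_sdiff (hanti (by omega : n ≤ n + M)) (hSm _)]
    refine measureReal_mono fun ω hω => ⟨hω.1, fun hω' => ?_⟩
    have h1 : ∀ j ≤ M, X (n + j) ω = X n ω + j := by
      intro j
      induction j with
      | zero => simp
      | succ j ih =>
        intro hj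
        have h2 : X (n + j + 1) ω = X (n + j) ω + 1 := hω.2 j (by omega)
        rw [← add_assoc, h2, ih (by omega)]
        push_cast
        ring
    have h2 := h1 M le_rfl
    have h3 : X n ω ∈ Set.Ioo x z := hω.1 n le_rfl
    have h4 : X (n + M) ω ∈ Set.Ioo x z := hω' (n + M) le_rfl
    rw [Set.mem_Ioo] at h3 h4
    omega
  have hconv : Tendsto (fun n => P.real (S n)) atTop (nhds (P.real (⋂ n, S n))) :=
    (ENNReal.tendsto_toReal (measure_ne_top _ _)).comp
      (tendsto_measure_iInter_atTop (fun n => (hSm n).nullMeasurableSet) hanti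
        ⟨0, measure_ne_top _ _⟩)
  have hlim := le_of_tendsto_of_tendsto' (hconv.const_mul ((1 / 2 : ℝ) ^ M))
    (hconv.sub (hconv.comp (tendsto_add_atTop_nat M))) fun n => (hlow n M).trans (hup n)
  rw [sub_self] at hlim
  have hzero : P.real (⋂ n, S n) = 0 :=
    le_antisymm (nonpos_of_mul_nonpos_right hlim (by positivity)) measureReal_nonneg
  have hset : {ω | ∀ n, X n ω ∈ Set.Ioo x z} = ⋂ n, S n := by
    ext ω
    simp only [hS, Set.mem_ofPred_eq, Set.mem_iInter]
    exact ⟨fun h n i _ => h i, fun h n => h n n le_rfl⟩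
  rw [hset]
  exact (measureReal_eq_zero_iff).1 hzero

lemma measure_hitTime_eq_top_le (hX : IsCookieRW P env X) {y : ℤ} (hX0 : ∀ᵐ ω ∂P, X 0 ω = y)
    {x z : ℤ} (hxy : x < y) (hyz : y < z) :
    P {ω | hitTime X x ω = ⊤} ≤ P {ω | hitTime X z ω < hitTime X x ω} := by
  refine measure_mono_ae ?_
  have hstuck : ∀ᵐ ω ∂P, ¬ ∀ n, X n ω ∈ Set.Ioo x z := by
    rw [ae_iff]
    simpa only [not_not] using hX.measure_forall_mem_Ioo x z
  filter_upwards [hX0, ae_all_iff.2 hX.steps, hstuck] with ω h0 hs hst htop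
  have h1 : ∀ m, X m ω ≠ x := hitTime_eq_top_iff.1 htop
  refine hitTime_lt_hitTime_iff.2 ?_
  by_contra! hc
  refine hst (mem_Ioo_of_steps (v := fun n => X n ω) hs ?_ h1 fun n hn => ?_)
  · rw [h0]; exact ⟨hxy, hyz⟩
  · obtain ⟨m, -, hm⟩ := hc n hn
    exact h1 m hm

lemma measure_hitTime_eq_top (hX : IsCookieRW P env X) (x : ℤ) :
    P {ω | hitTime X x ω = ⊤} = ⨅ n : ℕ, P {ω | ∀ m ≤ n, X m ω ≠ x} := by
  have : {ω | hitTime X x ω = ⊤} = ⋂ n : ℕ, {ω | ∀ m ≤ n, X m ω ≠ x} := by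
    ext ω
    simp only [Set.mem_ofPred_eq, Set.mem_iInter, hitTime_eq_top_iff]
    exact ⟨fun h n i _ => h i, fun h n => h n n le_rfl⟩
  rw [this]
  refine Antitone.measure_iInter (fun a b hab ω hω i hi => hω i (hi.trans hab)) (fun n => ?_)
    ⟨0, measure_ne_top _ _⟩
  exact (hX.natSA_le n _ (measurableSet_natSA_forall n fun _ => {x}ᶜ)).nullMeasurableSet

end IsCookieRW

/-- Monotonicity with respect to the environment. -/
theorem stmt12 (env₁ env₂ : ℤ → ℝ)
    (h₁ : ∀ z : ℤ, env₁ z ∈ Set.Ico (1 / 2 : ℝ) 1)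
    (h₂ : ∀ z : ℤ, env₂ z ∈ Set.Ico (1 / 2 : ℝ) 1)
    (hle : ∀ z : ℤ, env₁ z ≤ env₂ z) (y : ℤ)
    {Ω : Type*} [MeasurableSpace Ω] (P : Measure Ω) [IsProbabilityMeasure P]
    (X : ℕ → Ω → ℤ) (hX : IsCookieRW P env₁ X) (hX0 : ∀ᵐ ω ∂P, X 0 ω = y)
    {Ω' : Type*} [MeasurableSpace Ω'] (P' : Measure Ω') [IsProbabilityMeasure P']
    (X' : ℕ → Ω' → ℤ) (hX' : IsCookieRW P' env₂ X') (hX'0 : ∀ᵐ ω ∂P', X' 0 ω = y) :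
    (∀ x z : ℤ, x < y → y < z → ∀ N : ℕ, 1 ≤ N →
      P {ω | hitTime X z ω ≤ min (hitTime X x ω) (N : ℕ∞)} ≤
      P' {ω | hitTime X' z ω ≤ min (hitTime X' x ω) (N : ℕ∞)}) ∧
    (∀ x z : ℤ, x < y → y < z →
      P {ω | hitTime X z ω < hitTime X x ω} ≤
      P' {ω | hitTime X' z ω < hitTime X' x ω}) ∧
    (∀ x : ℤ, x < y →
      P {ω | hitTime X x ω = ⊤} ≤ P' {ω | hitTime X' x ω = ⊤}) := by
  have part1 : ∀ x z : ℤ, x < y → y < z → ∀ N : ℕ,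
      P {ω | hitTime X z ω ≤ min (hitTime X x ω) (N : ℕ∞)} ≤
      P' {ω | hitTime X' z ω ≤ min (hitTime X' x ω) (N : ℕ∞)} := by
    intro x z hxy hyz N
    have hxz : x ≠ z := by omega
    simp only [hitTime_le_min_iff hxz]
    simp only [← mem_hitBefore_iff (fun n => X n _), ← mem_hitBefore_iff (fun n => X' n _)]
    rw [hX.measure_prefix_eq hX0, hX'.measure_prefix_eq hX'0]
    refine measure_mono fun u hu => ?_
    obtain ⟨T, hTN, hT, hx⟩ := (mem_hitBefore_iff (stackWalk (cookieStack env₁ u) y)).1 hu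
    obtain ⟨n, hn, h⟩ := (followsStacks_stackWalk (cookieStack env₁ u) y).exists_hit
      (followsStacks_stackWalk (cookieStack env₂ u) y) (cookieStack_mono h₂ hle u) hxy hyz hT hx
    exact (mem_hitBefore_iff (stackWalk (cookieStack env₂ u) y)).2 ⟨n, hn.trans hTN, h⟩
  have part2 : ∀ x z : ℤ, x < y → y < z →
      P {ω | hitTime X z ω < hitTime X x ω} ≤
      P' {ω | hitTime X' z ω < hitTime X' x ω} := by
    intro x z hxy hyz
    have hxz : x ≠ z := by omega
    rw [hitTime_lt_eq_iUnion hxz, hitTime_lt_eq_iUnion hxz, monotone_hitTime_le_min.measure_iUnion,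
      monotone_hitTime_le_min.measure_iUnion]
    exact iSup_mono fun N => part1 x z hxy hyz N
  refine ⟨fun x z hxy hyz N _ => part1 x z hxy hyz N, part2, fun x hxy => ?_⟩
  rw [hX'.measure_hitTime_eq_top]
  refine le_iInf fun n => ?_
  have hyz : y < y + n + 1 := by omega
  exact (hX.measure_hitTime_eq_top_le hX0 hxy hyz).trans <|
    (part2 x _ hxy hyz).trans (hX'.measure_hitTime_lt_le hX'0 x n)
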